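/- Let d ≥ 1, p ∈ ℕ, let B ⊂ ℝ^d × ℝ be a closed ball of positive radius, and let ψ : ℝ^d × ℝ → ℂ be infinitely differentiable on an open set containing B and satisfy i ∂_t ψ + (1/2) Δ_x ψ = 0 there. For each (z, s) ∈ B let Ẽ_{(z,s)}(x, t) := Σ_{2 j_t + |j_x| ≤ 2p} (1/(j_x! j_t!)) D^{(j_x, j_t)} ψ(z, s) (x − z)^{j_x} (t − s)^{j_t} be the extended Taylor polynomial of degree 2p centered at (z, s). Then the extended averaged Taylor polynomial Q(x, t) := (1/|B|) ∫_B Ẽ_{(z,s)}(x, t) dV(z, s) is a polynomial in (x, t) of total degree at most 2p satisfying i ∂_t Q + (1/2) Δ_x Q = 0 on all of ℝ^d × ℝ. -/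

import Mathlib

noncomputable section

open MeasureTheory

/-- Spatial partial derivative `∂/∂x_ℓ` of a function on `ℝ^d × ℝ`. -/
def pS (d : ℕ) (ℓ : Fin d) (f : (Fin d → ℝ) × ℝ → ℂ) : (Fin d → ℝ) × ℝ → ℂ :=
  fun y => fderiv ℝ f y (Pi.single ℓ 1, 0)

/-- Time partial derivative `∂/∂t` of a function on `ℝ^d × ℝ`. -/
def pT (d : ℕ) (f : (Fin d → ℝ) × ℝ → ℂ) : (Fin d → ℝ) × ℝ → ℂ :=
  fun y => fderiv ℝ f y (0, 1)

/-- Multi-index partial derivative `D^{(j_x, j_t)}`. -/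
def Dm (d : ℕ) (jx : Fin d → ℕ) (jt : ℕ) (f : (Fin d → ℝ) × ℝ → ℂ) : (Fin d → ℝ) × ℝ → ℂ :=
  (pT d)^[jt] ((List.finRange d).foldr (fun ℓ g => (pS d ℓ)^[jx ℓ] ∘ g) id f)

/-- The extended Taylor polynomial of degree `2p` of `ψ` centered at `zs = (z, s)`. -/
def extTaylor (d p : ℕ) (ψ : (Fin d → ℝ) × ℝ → ℂ) (zs : (Fin d → ℝ) × ℝ) :
    (Fin d → ℝ) × ℝ → ℂ := fun y =>
  ∑ jt ∈ Finset.range (p + 1),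
    ∑ jx ∈ Fintype.piFinset (fun _ : Fin d => Finset.range (2 * p + 1)),
      if 2 * jt + ∑ ℓ, jx ℓ ≤ 2 * p then
        (((∏ ℓ, (jx ℓ).factorial) * jt.factorial : ℕ) : ℂ)⁻¹ * Dm d jx jt ψ zs *
          (∏ ℓ, ((y.1 ℓ - zs.1 ℓ : ℝ) : ℂ) ^ jx ℓ) * ((y.2 - zs.2 : ℝ) : ℂ) ^ jt
      else 0

/-- The extended averaged Taylor polynomial of degree `2p` over the ball `B`:
`Q(x,t) = (1/|B|) ∫_B Ẽ_{(z,s)}(x,t) dV(z,s)`. -/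
def extAvTaylor (d p : ℕ) (ψ : (Fin d → ℝ) × ℝ → ℂ) (B : Set ((Fin d → ℝ) × ℝ)) :
    (Fin d → ℝ) × ℝ → ℂ := fun y =>
  ((volume B).toReal)⁻¹ • ∫ zs in B, extTaylor d p ψ zs y

open Set

/-! ### Iterated directional derivatives of smooth functions on an open set -/

section DirDeriv

variable {E F : Type*} [NormedAddCommGroup E] [NormedSpace ℝ E]
  [NormedAddCommGroup F] [NormedSpace ℝ F] {U : Set E} {f g : E → F}

/-- The derivative of `f` in the direction `v`. -/
def dirDeriv (v : E) (f : E → F) : E → F := fun y => fderiv ℝ f y v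

theorem dirDeriv_congr (hU : IsOpen U) (v : E) (h : EqOn f g U) :
    EqOn (dirDeriv v f) (dirDeriv v g) U := fun y hy => by
  simp only [dirDeriv]
  rw [(h.eventuallyEq_of_mem (hU.mem_nhds hy)).fderiv_eq]

theorem ContDiffOn.dirDeriv (hU : IsOpen U) (v : E) (hf : ContDiffOn ℝ (⊤ : ℕ∞) f U) :
    ContDiffOn ℝ (⊤ : ℕ∞) (dirDeriv v f) U :=
  (hf.fderiv_of_isOpen hU (m := (⊤ : ℕ∞)) (by simp)).clm_apply contDiffOn_const

theorem dirDeriv_comm (hU : IsOpen U) (v w : E) (hf : ContDiffOn ℝ (⊤ : ℕ∞) f U) :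
    EqOn (dirDeriv v (dirDeriv w f)) (dirDeriv w (dirDeriv v f)) U := fun y hy => by
  have hd : DifferentiableAt ℝ (fderiv ℝ f) y :=
    ((hf.fderiv_of_isOpen hU (m := 1) (WithTop.coe_le_coe.2 le_top)).contDiffAt
      (hU.mem_nhds hy)).differentiableAt one_ne_zero
  have hs : IsSymmSndFDerivAt ℝ f y :=
    (hf.contDiffAt (hU.mem_nhds hy)).isSymmSndFDerivAt
      (by simpa using WithTop.coe_le_coe.2 (le_top : (2 : ℕ∞) ≤ ⊤))
  have key (a b : E) : _root_.dirDeriv a (_root_.dirDeriv b f) y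
      = fderiv ℝ (fderiv ℝ f) y a b := by
    change fderiv ℝ (fun y => fderiv ℝ f y b) y a = _
    rw [fderiv_clm_apply hd (differentiableAt_const b)]
    simp
  rw [key, key, hs]

theorem iterate_dirDeriv_congr (hU : IsOpen U) (v : E) (n : ℕ) (h : EqOn f g U) :
    EqOn ((dirDeriv v)^[n] f) ((dirDeriv v)^[n] g) U := by
  induction n with
  | zero => exact h
  | succ n ih =>
    simp only [Function.iterate_succ_apply']
    exact dirDeriv_congr hU v ih

theorem ContDiffOn.iterate_dirDeriv (hU : IsOpen U) (v : E) (n : ℕ)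
    (hf : ContDiffOn ℝ (⊤ : ℕ∞) f U) :
    ContDiffOn ℝ (⊤ : ℕ∞) ((_root_.dirDeriv v)^[n] f) U := by
  induction n with
  | zero => exact hf
  | succ n ih =>
    simp only [Function.iterate_succ_apply']
    exact ih.dirDeriv hU v

theorem dirDeriv_iterate_comm (hU : IsOpen U) (v w : E) (n : ℕ)
    (hf : ContDiffOn ℝ (⊤ : ℕ∞) f U) :
    EqOn (dirDeriv v ((dirDeriv w)^[n] f)) ((dirDeriv w)^[n] (dirDeriv v f)) U := by
  induction n with
  | zero => exact fun _ _ => rfl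
  | succ n ih =>
    simp only [Function.iterate_succ_apply']
    exact (dirDeriv_comm hU v w (hf.iterate_dirDeriv hU w n)).trans (dirDeriv_congr hU w ih)

end DirDeriv

/-! ### Smooth Trefftz functions -/

section Trefftz

variable {d : ℕ} {U : Set ((Fin d → ℝ) × ℝ)} {f : (Fin d → ℝ) × ℝ → ℂ}

/-- `f` is smooth and satisfies the Schrödinger equation on `U`. -/
structure IsTrefftzOn (d : ℕ) (f : (Fin d → ℝ) × ℝ → ℂ) (U : Set ((Fin d → ℝ) × ℝ)) : Prop where
  contDiffOn : ContDiffOn ℝ (⊤ : ℕ∞) f U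
  eq_zero : ∀ y ∈ U, Complex.I * pT d f y + (1 / 2 : ℂ) * ∑ ℓ, pS d ℓ (pS d ℓ f) y = 0

theorem pT_eq_dirDeriv : pT d = dirDeriv ((0, 1) : (Fin d → ℝ) × ℝ) := rfl

theorem pS_eq_dirDeriv (ℓ : Fin d) :
    pS d ℓ = dirDeriv ((Pi.single ℓ 1, 0) : (Fin d → ℝ) × ℝ) := rfl

theorem IsTrefftzOn.dirDeriv (hU : IsOpen U) (v : (Fin d → ℝ) × ℝ) (hf : IsTrefftzOn d f U) :
    IsTrefftzOn d (dirDeriv v f) U where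
  contDiffOn := hf.contDiffOn.dirDeriv hU v
  eq_zero y hy := by
    have hc := hf.contDiffOn
    have hdiff {g : (Fin d → ℝ) × ℝ → ℂ} (hg : ContDiffOn ℝ (⊤ : ℕ∞) g U) :
        DifferentiableAt ℝ g y :=
      (hg.contDiffAt (hU.mem_nhds hy)).differentiableAt (by simp)
    have h0 : EqOn (fun y => Complex.I * pT d f y + (1 / 2 : ℂ) * ∑ ℓ, pS d ℓ (pS d ℓ f) y)
        (fun _ => 0) U := hf.eq_zero
    have h1 := dirDeriv_congr hU v h0 hy
    have hT : DifferentiableAt ℝ (pT d f) y := hdiff (hc.dirDeriv hU _)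
    have hS (ℓ : Fin d) : DifferentiableAt ℝ (pS d ℓ (pS d ℓ f)) y :=
      hdiff ((hc.dirDeriv hU _).dirDeriv hU _)
    have hS' : DifferentiableAt ℝ (fun y => ∑ ℓ, pS d ℓ (pS d ℓ f) y) y :=
      DifferentiableAt.fun_sum fun ℓ _ => hS ℓ
    simp only [_root_.dirDeriv] at h1
    rw [fderiv_fun_add (hT.const_mul _) (hS'.const_mul _), fderiv_const_mul hT,
      fderiv_const_mul hS', fderiv_fun_sum fun ℓ _ => hS ℓ] at h1
    simp only [add_apply, smul_apply, sum_apply, smul_eq_mul, fderiv_fun_const, Pi.zero_apply,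
      zero_apply] at h1
    rw [← h1]
    congr 2
    · exact dirDeriv_comm hU _ _ hc hy
    · refine Finset.sum_congr rfl fun ℓ _ => ?_
      exact ((dirDeriv_congr hU _ (dirDeriv_comm hU _ v hc)).trans
        (dirDeriv_comm hU _ v (hc.dirDeriv hU _))) hy

theorem IsTrefftzOn.iterate_dirDeriv (hU : IsOpen U) (v : (Fin d → ℝ) × ℝ) (n : ℕ)
    (hf : IsTrefftzOn d f U) : IsTrefftzOn d ((_root_.dirDeriv v)^[n] f) U := by
  induction n with
  | zero => exact hf
  | succ n ih =>
    simp only [Function.iterate_succ_apply']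
    exact ih.dirDeriv hU v

/-- The purely spatial multi-index derivative, along a list of coordinates. -/
def spaceDeriv (d : ℕ) (jx : Fin d → ℕ) (l : List (Fin d)) (f : (Fin d → ℝ) × ℝ → ℂ) :
    (Fin d → ℝ) × ℝ → ℂ :=
  l.foldr (fun ℓ g => (pS d ℓ)^[jx ℓ] ∘ g) id f

theorem spaceDeriv_cons (jx : Fin d → ℕ) (ℓ : Fin d) (l : List (Fin d)) :
    spaceDeriv d jx (ℓ :: l) f = (pS d ℓ)^[jx ℓ] (spaceDeriv d jx l f) := rfl

theorem IsTrefftzOn.spaceDeriv (hU : IsOpen U) (jx : Fin d → ℕ) (l : List (Fin d))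
    (hf : IsTrefftzOn d f U) : IsTrefftzOn d (spaceDeriv d jx l f) U := by
  induction l with
  | nil => exact hf
  | cons ℓ l ih => exact ih.iterate_dirDeriv hU _ _

theorem IsTrefftzOn.Dm (hU : IsOpen U) (jx : Fin d → ℕ) (jt : ℕ) (hf : IsTrefftzOn d f U) :
    IsTrefftzOn d (Dm d jx jt f) U :=
  (hf.spaceDeriv hU jx _).iterate_dirDeriv hU _ _

theorem spaceDeriv_add_single_of_notMem (jx : Fin d → ℕ) (k : Fin d) {l : List (Fin d)}
    (hk : k ∉ l) : spaceDeriv d (jx + Pi.single k 1) l f = spaceDeriv d jx l f := by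
  induction l with
  | nil => rfl
  | cons ℓ l ih =>
    simp only [List.mem_cons, not_or] at hk
    rw [spaceDeriv_cons, spaceDeriv_cons, ih hk.2]
    simp [Pi.single_eq_of_ne (Ne.symm hk.1)]

theorem spaceDeriv_add_single (hU : IsOpen U) (jx : Fin d → ℕ) (k : Fin d) {l : List (Fin d)}
    (hl : l.Nodup) (hk : k ∈ l) (hf : IsTrefftzOn d f U) :
    EqOn (spaceDeriv d (jx + Pi.single k 1) l f) (pS d k (spaceDeriv d jx l f)) U := by
  induction l with
  | nil => simp at hk
  | cons ℓ l ih =>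
    rw [List.nodup_cons] at hl
    rw [spaceDeriv_cons, spaceDeriv_cons]
    by_cases h : k = ℓ
    · subst h
      rw [spaceDeriv_add_single_of_notMem jx k hl.1]
      simp only [Pi.add_apply, Pi.single_eq_same, Function.iterate_succ_apply']
      exact fun _ _ => rfl
    · have hk' : k ∈ l := by simpa [h] using hk
      have : (jx + Pi.single k 1 : Fin d → ℕ) ℓ = jx ℓ := by simp [Pi.single_eq_of_ne (Ne.symm h)]
      rw [this]
      exact (iterate_dirDeriv_congr hU _ _ (ih hl.2 hk')).trans
        (dirDeriv_iterate_comm hU _ _ _ (hf.spaceDeriv hU jx l).contDiffOn).symm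

theorem Dm_add_single (hU : IsOpen U) (jx : Fin d → ℕ) (jt : ℕ) (k : Fin d)
    (hf : IsTrefftzOn d f U) :
    EqOn (Dm d (jx + Pi.single k 1) jt f) (pS d k (Dm d jx jt f)) U :=
  (iterate_dirDeriv_congr hU _ _
    (spaceDeriv_add_single hU jx k (List.nodup_finRange d) (List.mem_finRange k) hf)).trans
    (dirDeriv_iterate_comm hU _ _ _ (hf.spaceDeriv hU jx _).contDiffOn).symm

theorem Dm_succ (jx : Fin d → ℕ) (jt : ℕ) : Dm d jx (jt + 1) f = pT d (Dm d jx jt f) :=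
  Function.iterate_succ_apply' _ _ _

/-- Differentiated form of the Schrödinger equation. -/
theorem IsTrefftzOn.Dm_eq_zero (hU : IsOpen U) (jx : Fin d → ℕ) (jt : ℕ)
    (hf : IsTrefftzOn d f U) {y : (Fin d → ℝ) × ℝ} (hy : y ∈ U) :
    Complex.I * _root_.Dm d jx (jt + 1) f y
      + (1 / 2 : ℂ) * ∑ ℓ, _root_.Dm d (jx + Pi.single ℓ 1 + Pi.single ℓ 1) jt f y = 0 := by
  rw [← (hf.Dm hU jx jt).eq_zero y hy, Dm_succ]
  congr 2
  refine Finset.sum_congr rfl fun ℓ _ => ?_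
  exact ((Dm_add_single hU _ jt ℓ hf).trans
    (dirDeriv_congr hU _ (Dm_add_single hU jx jt ℓ hf))) hy

end Trefftz

/-! ### Polynomials with coefficients in an algebra -/

section Polynomial

open MvPolynomial

variable {σ R : Type*} [CommRing R]

/-- Apply a linear functional to the coefficients of a polynomial. -/
def mapCoeff [Algebra ℂ R] (L : R →ₗ[ℂ] ℂ) (P : MvPolynomial σ R) : MvPolynomial σ ℂ :=
  ∑ m ∈ P.support, monomial m (L (coeff m P))

theorem coeff_mapCoeff [Algebra ℂ R] (L : R →ₗ[ℂ] ℂ) (P : MvPolynomial σ R) (m : σ →₀ ℕ) :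
    coeff m (mapCoeff L P) = L (coeff m P) := by
  classical
  rw [mapCoeff, coeff_sum]
  simp only [coeff_monomial, Finset.sum_ite_eq', mem_support_iff]
  split_ifs with h
  · rfl
  · rw [not_not.1 h, map_zero]

theorem totalDegree_mapCoeff_le [Algebra ℂ R] (L : R →ₗ[ℂ] ℂ) (P : MvPolynomial σ R) :
    (mapCoeff L P).totalDegree ≤ P.totalDegree := by
  refine Finset.sup_mono fun m hm => ?_
  rw [mem_support_iff, coeff_mapCoeff] at hm
  rw [mem_support_iff]
  exact fun h => hm (by rw [h, map_zero])

theorem eval_mapCoeff [Algebra ℂ R] (L : R →ₗ[ℂ] ℂ) (P : MvPolynomial σ R) (x : σ → ℂ) :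
    eval x (mapCoeff L P) = L (eval (fun i => algebraMap ℂ R (x i)) P) := by
  rw [mapCoeff, map_sum, eval_eq, map_sum]
  refine Finset.sum_congr rfl fun m _ => ?_
  rw [eval_monomial]
  simp only [← map_pow, ← map_prod]
  rw [mul_comm (coeff m P), ← Algebra.smul_def, map_smul, smul_eq_mul, mul_comm]
  rfl

/-- The Schrödinger operator on polynomials. -/
def schrodinger [Algebra ℂ R] (d : ℕ) (P : MvPolynomial (Option (Fin d)) R) :
    MvPolynomial (Option (Fin d)) R :=
  C (algebraMap ℂ R Complex.I) * pderiv none P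
    + C (algebraMap ℂ R (1 / 2)) * ∑ ℓ, pderiv (some ℓ) (pderiv (some ℓ) P)

theorem coeff_schrodinger [Algebra ℂ R] {d : ℕ} (P : MvPolynomial (Option (Fin d)) R)
    (m : Option (Fin d) →₀ ℕ) :
    coeff m (schrodinger d P) =
      Complex.I • (coeff (m + Finsupp.single none 1) P * (m none + 1))
      + (1 / 2 : ℂ) • ∑ ℓ : Fin d, coeff (m + Finsupp.single (some ℓ) 1 + Finsupp.single (some ℓ) 1) P
          * (m (some ℓ) + 2) * (m (some ℓ) + 1) := by
  simp only [schrodinger, coeff_add, coeff_C_mul, coeff_sum, coeff_pderiv, Algebra.smul_def]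
  congr 2
  refine Finset.sum_congr rfl fun ℓ _ => ?_
  simp
  ring

theorem schrodinger_mapCoeff [Algebra ℂ R] {d : ℕ} (L : R →ₗ[ℂ] ℂ)
    {P : MvPolynomial (Option (Fin d)) R} (hP : schrodinger d P = 0) :
    schrodinger d (mapCoeff L P) = 0 := by
  ext m
  have h := congrArg L (congrArg (coeff m) hP)
  have hL (a : R) (n : ℕ) : L (a * (n : R)) = L a * n := by
    rw [mul_comm, ← nsmul_eq_mul, map_nsmul, nsmul_eq_mul, mul_comm]
  rw [coeff_schrodinger] at h ⊢
  have e1 (n : ℕ) : (n : R) + 1 = ((n + 1 : ℕ) : R) := by push_cast; rfl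
  have e2 (n : ℕ) : (n : R) + 2 = ((n + 2 : ℕ) : R) := by push_cast; rfl
  simp only [map_add, map_smul, map_sum, e1, e2, hL, coeff_zero, map_zero] at h
  simp only [coeff_mapCoeff, coeff_zero]
  rw [← h]
  push_cast
  rfl

/-- The translation `X i ↦ X i - a i`. -/
def shiftVars (a : σ → R) : MvPolynomial σ R →ₐ[R] MvPolynomial σ R :=
  aeval fun i => X i - C (a i)

theorem pderiv_shiftVars (a : σ → R) (i : σ) (P : MvPolynomial σ R) :
    pderiv i (shiftVars a P) = shiftVars a (pderiv i P) := by
  classical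
  induction P using MvPolynomial.induction_on with
  | C r => simp [shiftVars, algebraMap_eq]
  | add p q hp hq => simp only [map_add, hp, hq]
  | mul_X p j hp =>
    simp only [map_mul, pderiv_mul, hp, map_add]
    congr 2
    simp only [shiftVars, aeval_X, map_sub, pderiv_X, pderiv_C, sub_zero]
    by_cases h : j = i
    · subst h; simp
    · simp [h]

theorem schrodinger_shiftVars [Algebra ℂ R] {d : ℕ} (a : Option (Fin d) → R)
    (P : MvPolynomial (Option (Fin d)) R) :
    schrodinger d (shiftVars a P) = shiftVars a (schrodinger d P) := by
  have hC (r : R) : shiftVars a (C r) = C r := aeval_C _ _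
  simp only [schrodinger, pderiv_shiftVars, map_add, map_mul, map_sum, hC]

theorem totalDegree_shiftVars_le (a : σ → R) (P : MvPolynomial σ R) :
    (shiftVars a P).totalDegree ≤ P.totalDegree := by
  rw [shiftVars, aeval_def, eval₂_eq]
  refine totalDegree_finsetSum_le fun m hm => ?_
  refine (totalDegree_mul _ _).trans ?_
  rw [algebraMap_eq, totalDegree_C, zero_add]
  refine (totalDegree_finsetProd _ _).trans (le_trans ?_ (le_totalDegree hm))
  refine Finset.sum_le_sum fun i _ => ?_
  refine (totalDegree_pow _ _).trans ?_
  refine (Nat.mul_le_mul_left _ (?_ : _ ≤ 1)).trans (mul_one _).le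
  refine (totalDegree_sub_C_le _ _).trans ?_
  cases subsingleton_or_nontrivial R
  · simp [Subsingleton.elim (X i : MvPolynomial σ R) 0]
  · rw [totalDegree_X]

theorem eval_shiftVars (a x : σ → R) (P : MvPolynomial σ R) :
    eval x (shiftVars a P) = eval (fun i => x i - a i) P := by
  induction P using MvPolynomial.induction_on with
  | C r => simp [shiftVars, algebraMap_eq]
  | add p q hp hq => simp only [map_add, hp, hq]
  | mul_X p j hp =>
    rw [map_mul, map_mul, hp, map_mul, eval_X, shiftVars, aeval_X, map_sub, eval_X, eval_C]

end Polynomial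

/-! ### Polynomial functions on space-time -/

section PolynomialFunction

open MvPolynomial

variable {d : ℕ}

/-- The complex-valued coordinates on `ℝ^d × ℝ`; `none` is time. -/
def coordC (d : ℕ) : Option (Fin d) → ((Fin d → ℝ) × ℝ →L[ℝ] ℂ)
  | none => Complex.ofRealCLM ∘L ContinuousLinearMap.snd ℝ (Fin d → ℝ) ℝ
  | some ℓ => Complex.ofRealCLM ∘L ContinuousLinearMap.proj ℓ ∘L
      ContinuousLinearMap.fst ℝ (Fin d → ℝ) ℝ

theorem elim_eq_coordC (y : (Fin d → ℝ) × ℝ) :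
    (fun v : Option (Fin d) => v.elim ((y.2 : ℝ) : ℂ) (fun ℓ => ((y.1 ℓ : ℝ) : ℂ)))
      = fun v => coordC d v y := by
  funext v
  cases v <;> rfl

theorem hasFDerivAt_eval_coordC (Q : MvPolynomial (Option (Fin d)) ℂ) (y : (Fin d → ℝ) × ℝ) :
    HasFDerivAt (fun y => eval (fun v => coordC d v y) Q)
      (∑ v, eval (fun v => coordC d v y) (pderiv v Q) • coordC d v) y := by
  classical
  induction Q using MvPolynomial.induction_on with
  | C r =>
    simp only [eval_C]
    refine (hasFDerivAt_const r y).congr_fderiv (ContinuousLinearMap.ext fun w => ?_)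
    simp only [pderiv_C, map_zero, sum_apply, smul_apply, zero_apply, smul_eq_mul, zero_mul,
      Finset.sum_const_zero]
  | add p q hp hq =>
    simp only [map_add]
    refine (hp.add hq).congr_fderiv (ContinuousLinearMap.ext fun w => ?_)
    simp only [sum_apply, add_apply, smul_apply, smul_eq_mul, add_mul, Finset.sum_add_distrib]
  | mul_X p j hp =>
    simp only [map_mul, eval_X]
    refine (hp.mul (coordC d j).hasFDerivAt).congr_fderiv
      (ContinuousLinearMap.ext fun w => ?_)
    simp only [pderiv_mul, pderiv_X, map_add, map_mul, eval_X, sum_apply, add_apply,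
      smul_apply, smul_eq_mul, add_mul, Finset.sum_add_distrib]
    rw [add_comm, Finset.mul_sum]
    congr 1
    · exact Finset.sum_congr rfl fun _ _ => by ring
    · rw [Finset.sum_eq_single j]
      · simp
      · intro b _ hb
        simp [hb.symm]
      · simp

theorem coordC_none_apply (y : (Fin d → ℝ) × ℝ) : coordC d none y = (y.2 : ℂ) := rfl

theorem coordC_some_apply (ℓ : Fin d) (y : (Fin d → ℝ) × ℝ) :
    coordC d (some ℓ) y = (y.1 ℓ : ℂ) := rfl

theorem pT_eval (Q : MvPolynomial (Option (Fin d)) ℂ) :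
    pT d (fun y => eval (fun v => coordC d v y) Q)
      = fun y => eval (fun v => coordC d v y) (pderiv none Q) := by
  funext y
  rw [pT, (hasFDerivAt_eval_coordC Q y).fderiv]
  simp [coordC_none_apply, coordC_some_apply]

theorem pS_eval (k : Fin d) (Q : MvPolynomial (Option (Fin d)) ℂ) :
    pS d k (fun y => eval (fun v => coordC d v y) Q)
      = fun y => eval (fun v => coordC d v y) (pderiv (some k) Q) := by
  funext y
  rw [pS, (hasFDerivAt_eval_coordC Q y).fderiv]
  simp [coordC_none_apply, coordC_some_apply, Pi.single_apply, apply_ite]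

theorem schrodinger_eval {Q : MvPolynomial (Option (Fin d)) ℂ} (hQ : schrodinger d Q = 0)
    (y : (Fin d → ℝ) × ℝ) :
    Complex.I * pT d (fun y => eval (fun v => coordC d v y) Q) y
      + (1 / 2 : ℂ) * ∑ ℓ, pS d ℓ (pS d ℓ (fun y => eval (fun v => coordC d v y) Q)) y = 0 := by
  have h := congrArg (eval fun v => coordC d v y) hQ
  simp only [schrodinger, map_add, map_mul, map_sum, eval_C, map_zero,
    Algebra.algebraMap_self, RingHom.id_apply] at h
  simpa only [pT_eval, pS_eval] using h

end PolynomialFunction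

/-! ### The generic Taylor polynomial -/

section TaylorPoly

open MvPolynomial

variable {R : Type*} [CommRing R] [Algebra ℂ R] {d : ℕ}

/-- The Taylor weight `1 / (jx! jt!)`. -/
def taylorWeight (jx : Fin d → ℕ) (jt : ℕ) : ℂ :=
  (((∏ ℓ, (jx ℓ).factorial) * jt.factorial : ℕ) : ℂ)⁻¹

theorem taylorWeight_succ (jx : Fin d → ℕ) (jt : ℕ) :
    taylorWeight jx (jt + 1) * (jt + 1) = taylorWeight jx jt := by
  have h : ((jt : ℂ) + 1) ≠ 0 := Nat.cast_add_one_ne_zero jt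
  simp only [taylorWeight, Nat.factorial_succ, Nat.cast_mul, Nat.cast_add, Nat.cast_one, mul_inv]
  field_simp

theorem taylorWeight_add_single (jx : Fin d → ℕ) (jt : ℕ) (k : Fin d) :
    taylorWeight (jx + Pi.single k 1) jt * (jx k + 1) = taylorWeight jx jt := by
  have h : ((jx k : ℂ) + 1) ≠ 0 := Nat.cast_add_one_ne_zero (jx k)
  have h' : ∏ ℓ, ((jx + Pi.single k 1 : Fin d → ℕ) ℓ).factorial
      = (jx k + 1) * ∏ ℓ, (jx ℓ).factorial := by
    rw [← Finset.mul_prod_erase _ _ (Finset.mem_univ k),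
      ← Finset.mul_prod_erase _ (fun ℓ => (jx ℓ).factorial) (Finset.mem_univ k), ← mul_assoc]
    congr 1
    · simp [Nat.factorial_succ]
    · refine Finset.prod_congr rfl fun ℓ hℓ => ?_
      simp [Pi.single_eq_of_ne (Finset.ne_of_mem_erase hℓ)]
  simp only [taylorWeight, h', Nat.cast_mul, Nat.cast_add, Nat.cast_one, mul_inv]
  field_simp

/-- The exponent with space part `jx` and time part `jt`. -/
def exponent (jx : Fin d → ℕ) (jt : ℕ) : Option (Fin d) →₀ ℕ :=
  Finsupp.equivFunOnFinite.symm fun v => v.elim jt jx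

@[simp]
theorem exponent_none (jx : Fin d → ℕ) (jt : ℕ) : exponent jx jt none = jt := rfl

@[simp]
theorem exponent_some (jx : Fin d → ℕ) (jt : ℕ) (ℓ : Fin d) : exponent jx jt (some ℓ) = jx ℓ := rfl

theorem eq_exponent_iff (m : Option (Fin d) →₀ ℕ) (jx : Fin d → ℕ) (jt : ℕ) :
    exponent jx jt = m ↔ jx = (fun ℓ => m (some ℓ)) ∧ jt = m none := by
  constructor
  · rintro rfl
    exact ⟨rfl, rfl⟩
  · rintro ⟨rfl, rfl⟩
    ext v
    cases v <;> rfl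

/-- The extended Taylor polynomial of degree `2p` with derivatives `A`, centered at the origin. -/
def taylorPoly (p : ℕ) (A : (Fin d → ℕ) → ℕ → R) : MvPolynomial (Option (Fin d)) R :=
  ∑ jt ∈ Finset.range (p + 1),
    ∑ jx ∈ Fintype.piFinset (fun _ : Fin d => Finset.range (2 * p + 1)),
      if 2 * jt + ∑ ℓ, jx ℓ ≤ 2 * p then
        monomial (exponent jx jt) (taylorWeight jx jt • A jx jt) else 0

theorem coeff_taylorPoly (p : ℕ) (A : (Fin d → ℕ) → ℕ → R) (m : Option (Fin d) →₀ ℕ) :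
    coeff m (taylorPoly p A) =
      if 2 * m none + ∑ ℓ, m (some ℓ) ≤ 2 * p then
        taylorWeight (fun ℓ => m (some ℓ)) (m none) • A (fun ℓ => m (some ℓ)) (m none) else 0 := by
  classical
  simp only [taylorPoly, coeff_sum, apply_ite (coeff m), coeff_monomial, coeff_zero,
    eq_exponent_iff]
  split_ifs with hm
  · rw [Finset.sum_eq_single (m none), Finset.sum_eq_single (fun ℓ => m (some ℓ))]
    · simp [hm]
    · intro jx _ h
      simp [h]
    · intro h
      refine absurd (Fintype.mem_piFinset.2 fun ℓ => Finset.mem_range.2 ?_) h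
      have := Finset.single_le_sum (f := fun ℓ => m (some ℓ)) (fun _ _ => Nat.zero_le _)
        (Finset.mem_univ ℓ)
      omega
    · intro jt _ h
      simp [h]
    · intro h
      refine absurd (Finset.mem_range.2 ?_) h
      omega
  · refine Finset.sum_eq_zero fun jt _ => Finset.sum_eq_zero fun jx _ => ?_
    split_ifs with h1 h2
    · rw [h2.1, h2.2] at h1
      exact absurd h1 hm
    · rfl
    · rfl

theorem coeff_exponent_taylorPoly (p : ℕ) (A : (Fin d → ℕ) → ℕ → R) (jx : Fin d → ℕ) (jt : ℕ) :
    coeff (exponent jx jt) (taylorPoly p A) =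
      if 2 * jt + ∑ ℓ, jx ℓ ≤ 2 * p then taylorWeight jx jt • A jx jt else 0 :=
  coeff_taylorPoly p A (exponent jx jt)

theorem totalDegree_taylorPoly_le (p : ℕ) (A : (Fin d → ℕ) → ℕ → R) :
    (taylorPoly p A).totalDegree ≤ 2 * p := by
  refine Finset.sup_le fun m hm => ?_
  rw [mem_support_iff, coeff_taylorPoly] at hm
  have h : 2 * m none + ∑ ℓ, m (some ℓ) ≤ 2 * p := by
    by_contra h
    exact hm (if_neg h)
  rw [Finsupp.sum_fintype _ _ fun _ => rfl, Fintype.sum_option]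
  omega

theorem schrodinger_taylorPoly (p : ℕ) {A : (Fin d → ℕ) → ℕ → R}
    (hA : ∀ jx jt, Complex.I • A jx (jt + 1)
      + (1 / 2 : ℂ) • ∑ ℓ, A (jx + Pi.single ℓ 1 + Pi.single ℓ 1) jt = 0) :
    schrodinger d (taylorPoly p A) = 0 := by
  ext m
  obtain ⟨jx, jt, rfl⟩ : ∃ jx jt, m = exponent jx jt :=
    ⟨_, _, ((eq_exponent_iff m _ _).2 ⟨rfl, rfl⟩).symm⟩
  have ht : exponent jx jt + Finsupp.single none 1 = exponent jx (jt + 1) := by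
    ext v
    cases v <;> simp
  have hx (jx : Fin d → ℕ) (ℓ : Fin d) :
      exponent jx jt + Finsupp.single (some ℓ) 1 = exponent (jx + Pi.single ℓ 1) jt := by
    ext v
    cases v <;> simp [Finsupp.single_apply, Pi.single_apply, eq_comm]
  have hcast (c : ℂ) (a : R) (n : ℕ) : (c • a) * (n : R) = (c * n) • a := by
    rw [mul_comm c, mul_smul, Nat.cast_smul_eq_nsmul, nsmul_eq_mul, mul_comm]
  have e1 (n : ℕ) : (n : R) + 1 = ((n + 1 : ℕ) : R) := by push_cast; rfl
  have e2 (n : ℕ) : (n : R) + 2 = ((n + 2 : ℕ) : R) := by push_cast; rfl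
  have hw (ℓ : Fin d) : taylorWeight (jx + Pi.single ℓ 1 + Pi.single ℓ 1) jt
      * ((jx ℓ + 2 : ℕ) : ℂ) * ((jx ℓ + 1 : ℕ) : ℂ) = taylorWeight jx jt := by
    rw [← taylorWeight_add_single jx jt ℓ, ← taylorWeight_add_single (jx + Pi.single ℓ 1) jt ℓ]
    simp only [Pi.add_apply, Pi.single_eq_same]
    push_cast
    ring
  have hsum (ℓ : Fin d) : ∑ k, (jx + Pi.single ℓ 1 + Pi.single ℓ 1 : Fin d → ℕ) k
      = ∑ k, jx k + 2 := by
    simp [Finset.sum_add_distrib]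
  rw [coeff_schrodinger, ht]
  simp only [hx, coeff_exponent_taylorPoly, exponent_none, exponent_some, coeff_zero, hsum]
  by_cases h : 2 * (jt + 1) + ∑ ℓ, jx ℓ ≤ 2 * p
  · have h' : 2 * jt + (∑ ℓ, jx ℓ + 2) ≤ 2 * p := by omega
    simp only [if_pos h, if_pos h', e1, e2, hcast, hw]
    rw [Nat.cast_add, Nat.cast_one, taylorWeight_succ, ← Finset.smul_sum, smul_comm, smul_comm (1 / 2 : ℂ),
      ← smul_add, hA, smul_zero]
  · have h' : ¬ 2 * jt + (∑ ℓ, jx ℓ + 2) ≤ 2 * p := by omega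
    simp [if_neg h, if_neg h']

theorem eval_taylorPoly (p : ℕ) (A : (Fin d → ℕ) → ℕ → R) (x : Option (Fin d) → R) :
    eval x (taylorPoly p A) = ∑ jt ∈ Finset.range (p + 1),
      ∑ jx ∈ Fintype.piFinset (fun _ : Fin d => Finset.range (2 * p + 1)),
        if 2 * jt + ∑ ℓ, jx ℓ ≤ 2 * p then
          taylorWeight jx jt • A jx jt * (∏ ℓ, x (some ℓ) ^ jx ℓ) * x none ^ jt else 0 := by
  simp only [taylorPoly, map_sum]
  refine Finset.sum_congr rfl fun jt _ => Finset.sum_congr rfl fun jx _ => ?_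
  split_ifs
  · rw [eval_monomial, Finsupp.prod_fintype _ _ fun _ => pow_zero _, Fintype.prod_option]
    simp only [exponent_none, exponent_some]
    ring
  · exact map_zero _

end TaylorPoly

/-! ### Averaging -/

section Average

variable {E : Type*} [TopologicalSpace E] [T2Space E] [MeasurableSpace E] [BorelSpace E]

theorem integrable_comap_of_isCompact {B : Set E} (hB : IsCompact B) (μ : Measure E)
    [IsFiniteMeasureOnCompacts μ] (f : C(B, ℂ)) :
    Integrable f (μ.comap Subtype.val) := by
  have : CompactSpace B := isCompact_iff_compactSpace.1 hB
  have : IsFiniteMeasure (μ.comap (Subtype.val : B → E)) :=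
    ⟨by
      rw [comap_subtype_coe_apply hB.measurableSet]
      simpa using hB.measure_lt_top⟩
  exact (BoundedContinuousFunction.mkOfCompact f).integrable _

/-- The average over the compact set `B`, as a linear functional on continuous functions. -/
def averageLM {B : Set E} (hB : IsCompact B) (μ : Measure E)
    [IsFiniteMeasureOnCompacts μ] : C(B, ℂ) →ₗ[ℂ] ℂ where
  toFun f := ((μ B).toReal)⁻¹ • ∫ z : B, f z ∂(μ.comap Subtype.val)
  map_add' f g := by
    rw [← smul_add, ← integral_add (integrable_comap_of_isCompact hB μ f)
      (integrable_comap_of_isCompact hB μ g)]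
    rfl
  map_smul' a f := by
    simp only [ContinuousMap.smul_apply, integral_smul, RingHom.id_apply]
    rw [smul_comm]

end Average

/-- If `ψ` is smooth and Trefftz (`i ∂_t ψ + (1/2) Δ_x ψ = 0`) on an open set `U` containing a
closed ball `B` of positive radius, then the extended averaged Taylor polynomial of degree `2p`
over `B` is a polynomial in `(x,t)` of total degree at most `2p` and is Trefftz on all of
`ℝ^d × ℝ`. -/
theorem extAvTaylor_is_trefftz_polynomial (d p : ℕ) (hd : 1 ≤ d)
    (c : (Fin d → ℝ) × ℝ) (r : ℝ) (hr : 0 < r)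
    (U : Set ((Fin d → ℝ) × ℝ)) (hU : IsOpen U) (hBU : Metric.closedBall c r ⊆ U)
    (ψ : (Fin d → ℝ) × ℝ → ℂ) (hsmooth : ContDiffOn ℝ (⊤ : ℕ∞) ψ U)
    (htrefftz : ∀ y ∈ U, Complex.I * pT d ψ y + (1/2 : ℂ) * ∑ ℓ, pS d ℓ (pS d ℓ ψ) y = 0) :
    (∃ Q : MvPolynomial (Option (Fin d)) ℂ, Q.totalDegree ≤ 2 * p ∧
      ∀ y : (Fin d → ℝ) × ℝ,
        MvPolynomial.eval (fun v => v.elim ((y.2 : ℝ) : ℂ) (fun ℓ => ((y.1 ℓ : ℝ) : ℂ))) Q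
          = extAvTaylor d p ψ (Metric.closedBall c r) y) ∧
    ∀ y : (Fin d → ℝ) × ℝ,
      Complex.I * pT d (extAvTaylor d p ψ (Metric.closedBall c r)) y
        + (1/2 : ℂ) * ∑ ℓ, pS d ℓ (pS d ℓ (extAvTaylor d p ψ (Metric.closedBall c r))) y
        = 0 := by
  have hB : IsCompact (Metric.closedBall c r) := isCompact_closedBall c r
  have hψ : IsTrefftzOn d ψ U := ⟨hsmooth, htrefftz⟩
  let coord (v : Option (Fin d)) : C(Metric.closedBall c r, ℂ) :=
    ⟨fun z => coordC d v z, by fun_prop⟩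
  let A (jx : Fin d → ℕ) (jt : ℕ) : C(Metric.closedBall c r, ℂ) :=
    ⟨fun z => Dm d jx jt ψ z,
      ((hψ.Dm hU jx jt).contDiffOn.continuousOn.mono hBU).domRestrict⟩
  have hA (jx : Fin d → ℕ) (jt : ℕ) : Complex.I • A jx (jt + 1)
      + (1 / 2 : ℂ) • ∑ ℓ, A (jx + Pi.single ℓ 1 + Pi.single ℓ 1) jt = 0 := by
    ext z

    simp only [ContinuousMap.add_apply, ContinuousMap.smul_apply, ContinuousMap.sum_apply,
      ContinuousMap.zero_apply, smul_eq_mul]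
    exact hψ.Dm_eq_zero hU jx jt (hBU z.2)
  let Q := mapCoeff (averageLM hB volume) (shiftVars coord (taylorPoly p A))
  have hQ (y : (Fin d → ℝ) × ℝ) : MvPolynomial.eval (fun v => coordC d v y) Q
      = extAvTaylor d p ψ (Metric.closedBall c r) y := by
    rw [eval_mapCoeff, eval_shiftVars, eval_taylorPoly, extAvTaylor,
      ← integral_subtype_comap hB.measurableSet]
    refine congrArg (fun w : ℂ => (volume (Metric.closedBall c r)).toReal⁻¹ • w)
      (integral_congr_ae (Filter.Eventually.of_forall fun z => ?_))
    simp only [ContinuousMap.sum_apply, extTaylor]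
    refine Finset.sum_congr rfl fun jt _ => Finset.sum_congr rfl fun jx _ => ?_
    split_ifs
    · have hAz : A jx jt z = Dm d jx jt ψ z := rfl
      simp [hAz, coord, taylorWeight, coordC_none_apply, coordC_some_apply]
      ring
    · rfl
  refine ⟨⟨Q, (totalDegree_mapCoeff_le _ _).trans ((totalDegree_shiftVars_le _ _).trans
    (totalDegree_taylorPoly_le p A)), fun y => ?_⟩, fun y => ?_⟩
  · rw [elim_eq_coordC, hQ]
  · rw [← funext hQ]
    refine schrodinger_eval (schrodinger_mapCoeff _ ?_) y
    rw [schrodinger_shiftVars, schrodinger_taylorPoly p hA, map_zero]
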